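/- arXiv:2505.19648 — 7 statements merged into one kernel-verified Lean document; each statement's English description precedes it below -/
import Mathlib

section
/- Let Γ be an SNF sentence over L, let M be a finite L-structure with M ⊨ Γ, and let a be an element of M. Let M′ be the L-structure on the type Option M (the elements of M together with one new element ⋆) obtained by pulling back all relations along the map g : Option M → M with g(⋆) = a and g(some x) = x; that is, for every unary relation symbol P of L, P^{M′}(u) holds iff P^M(g(u)) holds, and for every binary relation symbol R of L, R^{M′}(u,v) holds iff R^M(g(u), g(v)) holds. Then M′ ⊨ Γ, and the configuration of M′ agrees with the configuration of M at every 1-type except at the 1-type realized by a in M, where its value is larger by exactly 1. -/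
/-- An `L`-structure (for a language `L` with unary symbols `U` and binary
symbols `B`) on domain `D`. -/
structure Struc (U B : Type) (D : Type) where
  unary : U → D → Prop
  binary : B → D → D → Prop

/-- Quantifier-free formulas over relational atoms in the two variables `x`
(encoded as `false`) and `y` (encoded as `true`), built using `¬`, `∧`, `∨`
only (no equality). -/
inductive QF (U B : Type) where
  | uatom : U → Bool → QF U B
  | batom : B → Bool → Bool → QF U B
  | not : QF U B → QF U B
  | and : QF U B → QF U B → QF U B
  | or : QF U B → QF U B → QF U B

/-- Evaluation of a quantifier-free formula in a structure with `x ↦ a`, `y ↦ b`. -/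
def QF.Eval {U B D : Type} (S : Struc U B D) (a b : D) : QF U B → Prop
  | .uatom P v => S.unary P (if v then b else a)
  | .batom R v w => S.binary R (if v then b else a) (if w then b else a)
  | .not f => ¬ f.Eval S a b
  | .and f g => f.Eval S a b ∧ g.Eval S a b
  | .or f g => f.Eval S a b ∨ g.Eval S a b

/-- An SNF sentence `(∀x∀y φ(x,y)) ∧ ⋀_{k=1}^m (∀x∃y β_k(x,y))`. -/
structure SNF (U B : Type) where
  m : ℕ
  phi : QF U B
  beta : Fin m → B

/-- Satisfaction of an SNF sentence in a structure. -/
def SNF.Sat {U B D : Type} (Γ : SNF U B) (S : Struc U B D) : Prop :=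
  (∀ a b, Γ.phi.Eval S a b) ∧ ∀ k a, ∃ b, S.binary (Γ.beta k) a b

/-- A 1-type: a truth-value assignment to each atomic formula `P(x)`, `R(x,x)`. -/
structure OneType (U B : Type) where
  unary : U → Prop
  binary : B → Prop

/-- An element `e` realizes a 1-type `τ` in a structure `S`. -/
def Realizes1 {U B D : Type} (S : Struc U B D) (e : D) (τ : OneType U B) : Prop :=
  (∀ P, S.unary P e ↔ τ.unary P) ∧ (∀ R, S.binary R e e ↔ τ.binary R)

/-- The configuration of a structure: the number of elements realizing each 1-type. -/
noncomputable def config {U B D : Type} (S : Struc U B D) : OneType U B → ℕ :=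
  fun τ => Nat.card {e : D // Realizes1 S e τ}

/-- A configuration `n` is satisfiable w.r.t. `Γ`: some finite model of `Γ` has
configuration `n`. -/
def SatConfig {U B : Type} (Γ : SNF U B) (n : OneType U B → ℕ) : Prop :=
  ∃ (D : Type) (_ : Fintype D) (M : Struc U B D), Γ.Sat M ∧ config M = n

/-- The derivation relation `n ≼ n'` on configurations. -/
def Derives {U B : Type} (n n' : OneType U B → ℕ) : Prop :=
  ∀ τ, (0 < n τ → n τ ≤ n' τ) ∧ (n τ = 0 → n' τ = n τ)

theorem QF.eval_iff_of_pullback {U B D E : Type} {M : Struc U B D} {N : Struc U B E} (g : E → D)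
    (hU : ∀ P u, N.unary P u ↔ M.unary P (g u))
    (hB : ∀ R u v, N.binary R u v ↔ M.binary R (g u) (g v)) (f : QF U B) (u v : E) :
    f.Eval N u v ↔ f.Eval M (g u) (g v) := by
  induction f with
  | uatom P i => simp only [QF.Eval, hU, apply_ite g]
  | batom R i j => simp only [QF.Eval, hB, apply_ite g]
  | not f ih => simp only [QF.Eval, ih]
  | and f₁ f₂ ih₁ ih₂ => simp only [QF.Eval, ih₁, ih₂]
  | or f₁ f₂ ih₁ ih₂ => simp only [QF.Eval, ih₁, ih₂]

theorem SNF.Sat.of_pullback {U B D E : Type} {M : Struc U B D} {N : Struc U B E} {g : E → D}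
    {Γ : SNF U B} (hM : Γ.Sat M) (hg : Function.Surjective g)
    (hU : ∀ P u, N.unary P u ↔ M.unary P (g u))
    (hB : ∀ R u v, N.binary R u v ↔ M.binary R (g u) (g v)) : Γ.Sat N := by
  refine ⟨fun u v => (QF.eval_iff_of_pullback g hU hB _ u v).2 (hM.1 _ _), fun k u => ?_⟩
  obtain ⟨b, hb⟩ := hM.2 k (g u)
  obtain ⟨v, rfl⟩ := hg b
  exact ⟨v, (hB _ u v).2 hb⟩

theorem realizes1_iff_of_pullback {U B D E : Type} {M : Struc U B D} {N : Struc U B E} (g : E → D)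
    (hU : ∀ P u, N.unary P u ↔ M.unary P (g u))
    (hB : ∀ R u v, N.binary R u v ↔ M.binary R (g u) (g v)) (u : E) (τ : OneType U B) :
    Realizes1 N u τ ↔ Realizes1 M (g u) τ := by
  simp only [Realizes1, hU, hB]

theorem card_subtype_option_of_not_none {α : Type*} {p : Option α → Prop} (h : ¬ p none) :
    Nat.card {u // p u} = Nat.card {x // p (some x)} := by
  refine (Nat.card_congr (Equiv.ofBijective
    (fun x : {x // p (some x)} => (⟨some x.1, x.2⟩ : {u // p u})) ⟨?_, ?_⟩)).symm
  · rintro ⟨x, hx⟩ ⟨y, hy⟩ hxy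
    simpa using hxy
  · rintro ⟨_ | x, hx⟩
    · exact absurd hx h
    · exact ⟨⟨x, hx⟩, rfl⟩

theorem card_subtype_option_of_none {α : Type*} [Finite α] {p : Option α → Prop} (h : p none) :
    Nat.card {u // p u} = Nat.card {x // p (some x)} + 1 := by
  rw [← Finite.card_option]
  refine (Nat.card_congr (Equiv.ofBijective
    (fun o : Option {x // p (some x)} =>
      o.elim (⟨none, h⟩ : {u // p u}) fun x => ⟨some x.1, x.2⟩) ⟨?_, ?_⟩)).symm
  · rintro (_ | ⟨x, hx⟩) (_ | ⟨y, hy⟩) hxy <;> simp_all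
  · rintro ⟨_ | x, hx⟩
    · exact ⟨none, rfl⟩
    · exact ⟨some ⟨x, hx⟩, rfl⟩

/-- If `M ⊨ Γ` is a finite model and `a ∈ M`, then the structure
`M'` on `Option M` obtained by pulling back all relations along
`g : Option M → M`, `g ⋆ = a`, `g (some x) = x` (here `g u = u.getD a`) is again
a model of `Γ`, and its configuration agrees with that of `M` at every 1-type
except at the 1-type realized by `a`, where its value is larger by exactly 1. -/
theorem statement0 {U B : Type} [Fintype U] [Fintype B] {D : Type} [Fintype D]
    (Γ : SNF U B) (M : Struc U B D) (hM : Γ.Sat M) (a : D)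
    (M' : Struc U B (Option D))
    (hU : ∀ P u, M'.unary P u ↔ M.unary P (u.getD a))
    (hB : ∀ R u v, M'.binary R u v ↔ M.binary R (u.getD a) (v.getD a)) :
    Γ.Sat M' ∧
      (∀ τ, ¬ Realizes1 M a τ → config M' τ = config M τ) ∧
      (∀ τ, Realizes1 M a τ → config M' τ = config M τ + 1) := by
  have hR := realizes1_iff_of_pullback (fun u : Option D => u.getD a) hU hB
  refine ⟨hM.of_pullback (g := fun u : Option D => u.getD a) (fun x => ⟨some x, rfl⟩) hU hB,
    fun τ hτ => ?_, fun τ hτ => ?_⟩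
  · simpa only [config, hR, Option.getD_some] using
      card_subtype_option_of_not_none (p := fun u => Realizes1 M (u.getD a) τ) hτ
  · simpa only [config, hR, Option.getD_some] using
      card_subtype_option_of_none (p := fun u => Realizes1 M (u.getD a) τ) hτ
end

section
/- Let Γ be an SNF sentence over L. For all configurations n and n′ with n ≼ n′: if n is satisfiable with respect to Γ, then n′ is satisfiable with respect to Γ. -/
/-- The structure pulled back along a map of domains. -/
def Struc.comap {U B D E : Type} (S : Struc U B D) (f : E → D) : Struc U B E where
  unary P a := S.unary P (f a)
  binary R a b := S.binary R (f a) (f b)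

/-- Equality-free quantifier-free formulas are preserved by pullback. -/
theorem QF.eval_comap {U B D E : Type} (S : Struc U B D) (f : E → D) (a b : E)
    (φ : QF U B) : φ.Eval (S.comap f) a b ↔ φ.Eval S (f a) (f b) := by
  induction φ with
  | uatom P v => simp only [QF.Eval, Struc.comap, apply_ite f]
  | batom R v w => simp only [QF.Eval, Struc.comap, apply_ite f]
  | not φ ih => simp only [QF.Eval, ih]
  | and φ ψ ih₁ ih₂ => simp only [QF.Eval, ih₁, ih₂]
  | or φ ψ ih₁ ih₂ => simp only [QF.Eval, ih₁, ih₂]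

/-- Models of an SNF sentence are closed under pullback along surjections. -/
theorem SNF.Sat.comap {U B D E : Type} {Γ : SNF U B} {S : Struc U B D} (hS : Γ.Sat S)
    {f : E → D} (hf : Function.Surjective f) : Γ.Sat (S.comap f) := by
  refine ⟨fun a b => (QF.eval_comap S f a b _).2 (hS.1 _ _), fun k a => ?_⟩
  obtain ⟨d, hd⟩ := hS.2 k (f a)
  obtain ⟨b, rfl⟩ := hf d
  exact ⟨b, hd⟩

theorem Realizes1.unique {U B D : Type} {S : Struc U B D} {e : D} {τ σ : OneType U B}
    (hτ : Realizes1 S e τ) (hσ : Realizes1 S e σ) : τ = σ := by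
  cases τ
  cases σ
  congr 1
  · exact funext fun P => propext ((hτ.1 P).symm.trans (hσ.1 P))
  · exact funext fun R => propext ((hτ.2 R).symm.trans (hσ.2 R))

theorem exists_realizes1 {U B D : Type} (S : Struc U B D) (e : D) : ∃ τ, Realizes1 S e τ :=
  ⟨⟨fun P => S.unary P e, fun R => S.binary R e e⟩, fun _ => Iff.rfl, fun _ => Iff.rfl⟩

instance OneType.instFinite {U B : Type} [Finite U] [Finite B] : Finite (OneType U B) :=
  Finite.of_injective (fun τ : OneType U B => (τ.unary, τ.binary)) fun τ σ h => by
    cases τ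
    cases σ
    simpa using h

theorem exists_surjective_fin {α : Type} [Finite α] {k : ℕ}
    (hpos : 0 < Nat.card α → Nat.card α ≤ k) (hzero : Nat.card α = 0 → k = 0) :
    ∃ f : Fin k → α, Function.Surjective f := by
  rcases isEmpty_or_nonempty α with hα | hα
  · obtain rfl := hzero Nat.card_of_isEmpty
    exact ⟨Fin.elim0, fun a => isEmptyElim a⟩
  · let e := Finite.equivFin α
    let g : α → Fin k := fun a => Fin.castLE (hpos Nat.card_pos) (e a)
    have hg : Function.Injective g := (Fin.castLE_injective _).comp e.injective
    exact ⟨Function.invFun g, Function.invFun_surjective hg⟩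

/-- Monotonicity of configuration satisfiability: if `n ≼ n'`
and `n` is satisfiable w.r.t. an SNF sentence `Γ`, then so is `n'`. -/
theorem statement1 {U B : Type} [Fintype U] [Fintype B] (Γ : SNF U B)
    (n n' : OneType U B → ℕ) (h : Derives n n') (hn : SatConfig Γ n) :
    SatConfig Γ n' := by
  obtain ⟨D, _, M, hM, rfl⟩ := hn
  choose f hf using fun τ => exists_surjective_fin (α := {e : D // Realizes1 M e τ})
    (h τ).1 fun h0 => ((h τ).2 h0).trans h0
  let π : (Σ τ, Fin (n' τ)) → D := fun x => (f x.1 x.2).1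
  have hπ : Function.Surjective π := fun d => by
    obtain ⟨τ, hτ⟩ := exists_realizes1 M d
    obtain ⟨i, hi⟩ := hf τ ⟨d, hτ⟩
    exact ⟨⟨τ, i⟩, congrArg Subtype.val hi⟩
  refine ⟨Σ τ, Fin (n' τ), Fintype.ofFinite _, M.comap π, hM.comap hπ, funext fun τ => ?_⟩
  have key (x : Σ τ, Fin (n' τ)) : Realizes1 (M.comap π) x τ ↔ x.1 = τ :=
    ⟨fun hx => Realizes1.unique (S := M) (f x.1 x.2).2 hx,
      fun hx => hx ▸ (f x.1 x.2).2⟩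
  calc config (M.comap π) τ = Nat.card {x : Σ τ, Fin (n' τ) // x.1 = τ} :=
        Nat.card_congr (Equiv.subtypeEquivRight key)
    _ = Nat.card (Fin (n' τ)) := Nat.card_congr (Equiv.sigmaSubtype τ)
    _ = n' τ := Nat.card_fin _
end

section
/- Let Γ be an SNF sentence over L with m existentially quantified conjuncts, and set δ = max(m(m+1), 2m+1). If a configuration n is satisfiable with respect to Γ, then the configuration τ ↦ min(n(τ), δ) is satisfiable with respect to Γ. -/
/-- The 1-type realized by an element of a structure. -/
def Struc.oneType {U B D : Type} (S : Struc U B D) (e : D) : OneType U B where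
  unary P := S.unary P e
  binary R := S.binary R e e

theorem realizes1_iff {U B D : Type} (S : Struc U B D) (e : D) (τ : OneType U B) :
    Realizes1 S e τ ↔ S.oneType e = τ := by
  constructor
  · rintro ⟨h₁, h₂⟩
    cases τ
    simp only [Struc.oneType, OneType.mk.injEq]
    exact ⟨funext fun P => propext (h₁ P), funext fun R => propext (h₂ R)⟩
  · rintro rfl
    exact ⟨fun _ => Iff.rfl, fun _ => Iff.rfl⟩

theorem config_apply {U B D : Type} (S : Struc U B D) (τ : OneType U B) :
    config S τ = Nat.card {e : D // S.oneType e = τ} :=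
  Nat.card_congr (Equiv.subtypeEquivRight fun e => realizes1_iff S e τ)

/-- Quantifier-free formulas without equality only depend on the 1-types of the two elements and
on the binary relations between them. -/
theorem QF.eval_congr {U B D D' : Type} {S : Struc U B D} {S' : Struc U B D'} {a b : D}
    {x y : D'} (hx : S'.oneType x = S.oneType a) (hy : S'.oneType y = S.oneType b)
    (hxy : ∀ R, S'.binary R x y ↔ S.binary R a b) (hyx : ∀ R, S'.binary R y x ↔ S.binary R b a)
    (φ : QF U B) : φ.Eval S' x y ↔ φ.Eval S a b := by
  simp only [Struc.oneType, OneType.mk.injEq, funext_iff, eq_iff_iff] at hx hy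
  induction φ with
  | uatom P v => cases v <;> simp [QF.Eval, hx, hy]
  | batom R v w => cases v <;> cases w <;> simp [QF.Eval, hx, hy, hxy, hyx]
  | not f hf => simp [QF.Eval, hf]
  | and f g hf hg => simp [QF.Eval, hf, hg]
  | or f g hf hg => simp [QF.Eval, hf, hg]

/-- A structure in which every pair of elements copies a pair of elements of a given model is
again a model, provided that the copying is coherent and provides witnesses. -/
theorem SNF.Sat.exists_of_copy {U B D D' : Type} {Γ : SNF U B} {S : Struc U B D} (hS : Γ.Sat S)
    (r : D' → D) (E : D' → D' → D → D → Prop)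
    (total : ∀ x y, ∃ p q, E x y p q)
    (functional : ∀ x y p q p' q', E x y p q → E x y p' q' → p = p' ∧ q = q')
    (symm : ∀ x y p q, E x y p q → E y x q p)
    (diag : ∀ x, E x x (r x) (r x))
    (typed : ∀ x y p q, E x y p q → S.oneType p = S.oneType (r x))
    (witness : ∀ k x, ∃ y p q, E x y p q ∧ S.binary (Γ.beta k) p q) :
    ∃ S' : Struc U B D', Γ.Sat S' ∧ ∀ x, S'.oneType x = S.oneType (r x) := by
  let S' : Struc U B D' :=
    { unary := fun P x => S.unary P (r x)
      binary := fun R x y => ∃ p q, E x y p q ∧ S.binary R p q }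
  have hbin : ∀ R x y p q, E x y p q → (S'.binary R x y ↔ S.binary R p q) := by
    intro R x y p q h
    constructor
    · rintro ⟨p', q', h', hR⟩
      obtain ⟨rfl, rfl⟩ := functional _ _ _ _ _ _ h h'
      exact hR
    · exact fun hR => ⟨p, q, h, hR⟩
  have htype : ∀ x, S'.oneType x = S.oneType (r x) := by
    intro x
    simp only [Struc.oneType, OneType.mk.injEq]
    exact ⟨rfl, funext fun R => propext (hbin R x x _ _ (diag x))⟩
  refine ⟨S', ⟨fun x y => ?_, fun k x => ?_⟩, htype⟩
  · obtain ⟨p, q, h⟩ := total x y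
    have h' := symm _ _ _ _ h
    refine (QF.eval_congr (S := S) (a := p) (b := q) ?_ ?_ ?_ ?_ Γ.phi).2 (hS.1 p q)
    · rw [htype, typed _ _ _ _ h]
    · rw [htype, typed _ _ _ _ h']
    · exact fun R => hbin R _ _ _ _ h
    · exact fun R => hbin R _ _ _ _ h'
  · obtain ⟨y, p, q, h, hR⟩ := witness k x
    exact ⟨y, p, q, h, hR⟩

/-- A variant of `SNF.Sat.exists_of_copy`: the pairs that are not subject to a demand copy the
pair of their representatives. -/
theorem SNF.Sat.exists_of_demand {U B D D' : Type} {Γ : SNF U B} {S : Struc U B D}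
    (hS : Γ.Sat S) (r : D' → D) (dem : D' → D' → D → D → Prop)
    (functional : ∀ x y p q p' q', dem x y p q → dem x y p' q' → p = p' ∧ q = q')
    (asymm : ∀ x y p q p' q', dem x y p q → ¬ dem y x p' q')
    (typed : ∀ x y p q, dem x y p q →
      S.oneType p = S.oneType (r x) ∧ S.oneType q = S.oneType (r y))
    (witness : ∀ k x, ∃ y, (∃ p q, dem x y p q ∧ S.binary (Γ.beta k) p q) ∨
      ((∀ p q, ¬ dem x y p q) ∧ (∀ p q, ¬ dem y x p q) ∧ S.binary (Γ.beta k) (r x) (r y))) :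
    ∃ S' : Struc U B D', Γ.Sat S' ∧ ∀ x, S'.oneType x = S.oneType (r x) := by
  refine hS.exists_of_copy r (fun x y p q => dem x y p q ∨ dem y x q p ∨
    ((∀ p q, ¬ dem x y p q) ∧ (∀ p q, ¬ dem y x p q) ∧ p = r x ∧ q = r y)) ?_ ?_ ?_ ?_ ?_ ?_
  · intro x y
    by_cases h₁ : ∃ p q, dem x y p q
    · obtain ⟨p, q, h⟩ := h₁
      exact ⟨p, q, Or.inl h⟩
    by_cases h₂ : ∃ p q, dem y x p q
    · obtain ⟨p, q, h⟩ := h₂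
      exact ⟨q, p, Or.inr (Or.inl h)⟩
    push Not at h₁ h₂
    exact ⟨r x, r y, Or.inr (Or.inr ⟨h₁, h₂, rfl, rfl⟩)⟩
  · rintro x y p q p' q' (h | h | ⟨h₁, h₂, rfl, rfl⟩) (h' | h' | ⟨h₁', h₂', rfl, rfl⟩)
    · exact functional _ _ _ _ _ _ h h'
    · exact absurd h' (asymm _ _ _ _ _ _ h)
    · exact absurd h (h₁' _ _)
    · exact absurd h' (asymm _ _ _ _ _ _ h)
    · exact (functional _ _ _ _ _ _ h h').symm
    · exact absurd h (h₂' _ _)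
    · exact absurd h' (h₁ _ _)
    · exact absurd h' (h₂ _ _)
    · exact ⟨rfl, rfl⟩
  · rintro x y p q (h | h | ⟨h₁, h₂, h₃, h₄⟩)
    · exact Or.inr (Or.inl h)
    · exact Or.inl h
    · exact Or.inr (Or.inr ⟨h₂, h₁, h₄, h₃⟩)
  · intro x
    have h : ∀ p q, ¬ dem x x p q := fun p q h => asymm _ _ _ _ _ _ h h
    exact Or.inr (Or.inr ⟨h, h, rfl, rfl⟩)
  · rintro x y p q (h | h | ⟨-, -, rfl, -⟩)
    · exact (typed _ _ _ _ h).1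
    · exact (typed _ _ _ _ h).2
    · rfl
  · intro k x
    obtain ⟨y, ⟨p, q, h, hR⟩ | ⟨h₁, h₂, hR⟩⟩ := witness k x
    · exact ⟨y, p, q, Or.inl h, hR⟩
    · exact ⟨y, _, _, Or.inr (Or.inr ⟨h₁, h₂, rfl, rfl⟩), hR⟩

/-- In a cyclic group of order greater than `2 * m`, the residues `1, …, m` are distinct and no
two of them add up to zero. -/
theorem exists_injective_zmod_add_ne_zero (m δ : ℕ) (h : 2 * m + 1 ≤ δ) :
    ∃ c : Fin m → ZMod δ, Function.Injective c ∧ ∀ k l, c k + c l ≠ 0 := by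
  refine ⟨fun k => ((k + 1 : ℕ) : ZMod δ), fun k l hkl => ?_, fun k l hkl => ?_⟩
  · have hk := k.2
    have hl := l.2
    have := (ZMod.natCast_eq_natCast_iff' _ _ _).1 hkl
    rw [Nat.mod_eq_of_lt (by omega), Nat.mod_eq_of_lt (by omega)] at this
    exact Fin.ext (by omega)
  · have hk := k.2
    have hl := l.2
    rw [← Nat.cast_add, ZMod.natCast_eq_zero_iff] at hkl
    have := Nat.le_of_dvd (by omega) hkl
    omega

/-- The representatives used for an abundant type with typical element `b`: the indices in the
range of `g` represent `b`, and all second-order witnesses of `b` in the type are represented at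
other indices. -/
theorem exists_representatives {D T I : Type} {m : ℕ} (tp : D → T) (w : Fin m → D → D)
    (e : (Fin m × Fin m) ⊕ Fin m ↪ I) (b : D) :
    ∃ ρ : I → D, (∀ i, tp (ρ i) = tp b) ∧ (∀ k, ρ (e (Sum.inr k)) = b) ∧
      ∀ k l, tp (w k (w l b)) = tp b →
        ∃ i, (∀ j, i ≠ e (Sum.inr j)) ∧ ρ i = w k (w l b) := by
  classical
  let f : (Fin m × Fin m) ⊕ Fin m → D := Sum.elim
    (fun s => if tp (w s.1 (w s.2 b)) = tp b then w s.1 (w s.2 b) else b) (fun _ => b)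
  have hf : ∀ s, tp (f s) = tp b := by
    rintro (s | s)
    · by_cases h : tp (w s.1 (w s.2 b)) = tp b <;> simp [f, h]
    · rfl
  refine ⟨Function.extend e f fun _ => b, fun i => ?_, fun k => ?_, fun k l h => ?_⟩
  · by_cases hi : ∃ s, e s = i
    · obtain ⟨s, rfl⟩ := hi
      rw [e.injective.extend_apply, hf]
    · rw [Function.extend_apply' _ _ _ hi]
  · rw [e.injective.extend_apply]
    rfl
  · refine ⟨e (Sum.inl (k, l)), fun j hj => ?_, ?_⟩
    · simpa using e.injective hj
    · rw [e.injective.extend_apply]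
      simp [f, h]

/-- Every 1-type realized more than `δ` times can be cut down to exactly `δ` realizations, leaving
the remaining 1-types unchanged. -/
theorem SNF.Sat.exists_truncation {U B D : Type} {Γ : SNF U B} {S : Struc U B D}
    (hS : Γ.Sat S) (δ : ℕ) (h₁ : Γ.m * (Γ.m + 1) ≤ δ) (h₂ : 2 * Γ.m + 1 ≤ δ)
    (A : Set (OneType U B)) (hA : ∀ τ ∈ A, ∃ b, S.oneType b = τ) :
    ∃ S' : Struc U B ({a : D // S.oneType a ∉ A} ⊕ (A × ZMod δ)), Γ.Sat S' ∧
      (∀ a, S'.oneType (Sum.inl a) = S.oneType a) ∧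
      ∀ τ i, S'.oneType (Sum.inr (τ, i)) = τ := by
  have : NeZero δ := ⟨by omega⟩
  choose w hw using hS.2
  obtain ⟨c, hc, hc'⟩ := exists_injective_zmod_add_ne_zero Γ.m δ h₂
  obtain ⟨e⟩ : Nonempty ((Fin Γ.m × Fin Γ.m) ⊕ Fin Γ.m ↪ ZMod δ) := by
    apply Function.Embedding.nonempty_of_card_le
    simp only [Fintype.card_sum, Fintype.card_prod, Fintype.card_fin, ZMod.card]
    linarith
  choose b hb using fun τ : A => hA τ.1 τ.2
  choose ρ hρ hρb hρw using fun τ : A => exists_representatives S.oneType w e (b τ)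
  let r : {a : D // S.oneType a ∉ A} ⊕ (A × ZMod δ) → D :=
    Sum.elim (fun a => a.1) (fun s => ρ s.1 s.2)
  let dem : {a : D // S.oneType a ∉ A} ⊕ (A × ZMod δ) →
      {a : D // S.oneType a ∉ A} ⊕ (A × ZMod δ) → D → D → Prop := fun x y p q =>
    match x, y with
    | Sum.inl a, Sum.inr (τ, j) => ∃ k, j = e (Sum.inr k) ∧ p = a.1 ∧ q = w k a.1 ∧
        S.oneType q = τ ∧ ∀ l, a.1 ≠ w l (b τ)
    | Sum.inr (τ, i), Sum.inr (τ', j) => ∃ k, j = i + c k ∧ p = ρ τ i ∧ q = w k (ρ τ i) ∧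
        S.oneType q = τ'
    | _, Sum.inl _ => False
  suffices h : ∃ S' : Struc U B _, Γ.Sat S' ∧ ∀ x, S'.oneType x = S.oneType (r x) by
    obtain ⟨S', hS', htype⟩ := h
    refine ⟨S', hS', fun a => htype _, fun τ i => ?_⟩
    rw [htype, ← hb τ]
    exact hρ τ i
  refine hS.exists_of_demand r dem ?_ ?_ ?_ ?_
  · rintro (a | ⟨τ, i⟩) (a' | ⟨τ', j⟩) p q p' q' h h'
    · exact h.elim
    · obtain ⟨k, hk, rfl, rfl, -⟩ := h
      obtain ⟨k', hk', rfl, rfl, -⟩ := h'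
      obtain rfl : k = k' := by simpa using e.injective (hk.symm.trans hk')
      exact ⟨rfl, rfl⟩
    · exact h.elim
    · obtain ⟨k, hk, rfl, rfl, -⟩ := h
      obtain ⟨k', hk', rfl, rfl, -⟩ := h'
      obtain rfl : k = k' := hc (add_left_cancel (hk.symm.trans hk'))
      exact ⟨rfl, rfl⟩
  · rintro (a | ⟨τ, i⟩) (a' | ⟨τ', j⟩) p q p' q' h h'
    · exact h
    · exact h'
    · exact h
    · obtain ⟨k, hk, -⟩ := h
      obtain ⟨l, hl, -⟩ := h'
      apply hc' k l
      rw [hk, add_assoc] at hl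
      exact left_eq_add.1 hl
  · rintro (a | ⟨τ, i⟩) (a' | ⟨τ', j⟩) p q h
    · exact h.elim
    · obtain ⟨k, -, rfl, -, hq, -⟩ := h
      exact ⟨rfl, hq.trans ((hb τ').symm.trans (hρ τ' j).symm)⟩
    · exact h.elim
    · obtain ⟨k, -, rfl, -, hq⟩ := h
      exact ⟨rfl, hq.trans ((hb τ').symm.trans (hρ τ' j).symm)⟩
  · rintro k (a | ⟨τ, i⟩)
    · by_cases hk : S.oneType (w k a.1) ∈ A
      · by_cases ha : ∀ l, a.1 ≠ w l (b ⟨_, hk⟩)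
        · exact ⟨Sum.inr (⟨_, hk⟩, e (Sum.inr k)), Or.inl ⟨_, _, ⟨k, rfl, rfl, rfl, rfl, ha⟩,
            hw k a.1⟩⟩
        · push Not at ha
          obtain ⟨l, hl⟩ := ha
          obtain ⟨i, hi, hi'⟩ := hρw ⟨_, hk⟩ k l (by rw [← hl, hb])
          refine ⟨Sum.inr (⟨_, hk⟩, i), Or.inr ⟨?_, fun _ _ h => h, ?_⟩⟩
          · rintro p q ⟨j, hj, -⟩
            exact hi j hj
          · change S.binary _ a.1 (ρ _ i)
            rw [hi', ← hl]
            exact hw k a.1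
      · exact ⟨Sum.inl ⟨_, hk⟩, Or.inr ⟨fun _ _ h => h, fun _ _ h => h, hw k a.1⟩⟩
    · by_cases hk : S.oneType (w k (ρ τ i)) ∈ A
      · exact ⟨Sum.inr (⟨_, hk⟩, i + c k), Or.inl ⟨_, _, ⟨k, rfl, rfl, rfl, rfl⟩, hw k _⟩⟩
      · refine ⟨Sum.inl ⟨_, hk⟩, Or.inr ⟨fun _ _ h => h, ?_, hw k _⟩⟩
        rintro p q ⟨j, rfl, -, -, -, h⟩
        exact h k (congrArg (w k) (hρb τ j))

/-- With `δ = max (m(m+1)) (2m+1)`, if `n` is satisfiable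
w.r.t. `Γ`, then the configuration `τ ↦ min (n τ) δ` is satisfiable. -/
theorem statement3 {U B : Type} [Fintype U] [Fintype B] (Γ : SNF U B)
    (n : OneType U B → ℕ) (hn : SatConfig Γ n) :
    SatConfig Γ (fun τ => min (n τ) (max (Γ.m * (Γ.m + 1)) (2 * Γ.m + 1))) := by
  obtain ⟨D, _, S, hS, rfl⟩ := hn
  set δ := max (Γ.m * (Γ.m + 1)) (2 * Γ.m + 1)
  have h₁ : Γ.m * (Γ.m + 1) ≤ δ := le_max_left _ _
  have h₂ : 2 * Γ.m + 1 ≤ δ := le_max_right _ _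
  have : NeZero δ := ⟨by omega⟩
  let A : Set (OneType U B) := {τ | δ < config S τ}
  have hA : ∀ τ ∈ A, ∃ b, S.oneType b = τ := by
    intro τ hτ
    have hτ' : δ < config S τ := hτ
    rw [config_apply] at hτ'
    obtain ⟨⟨b, hb⟩⟩ := (Nat.card_pos_iff.1 (Nat.zero_lt_of_lt hτ')).1
    exact ⟨b, hb⟩
  have : Finite A := ((Set.finite_range S.oneType).subset hA).to_subtype
  obtain ⟨S', hS', hl, hr⟩ := hS.exists_truncation δ h₁ h₂ A hA
  refine ⟨_, Fintype.ofFinite _, S', hS', funext fun τ => ?_⟩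
  rw [config_apply]
  by_cases hτ : τ ∈ A
  · rw [min_eq_right (le_of_lt hτ)]
    let f : ZMod δ → {x // S'.oneType x = τ} := fun i => ⟨Sum.inr (⟨τ, hτ⟩, i), hr _ i⟩
    have hf : Function.Bijective f := by
      refine ⟨fun i j hij => by simpa [f] using hij, ?_⟩
      rintro ⟨a | ⟨τ', i⟩, h⟩
      · rw [hl] at h
        exact absurd (h ▸ hτ) a.2
      · rw [hr] at h
        subst h
        exact ⟨i, rfl⟩
    rw [← Nat.card_congr (Equiv.ofBijective f hf), Nat.card_zmod]
  · rw [min_eq_left (not_lt.1 hτ), config_apply]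
    let f : {a // S.oneType a = τ} → {x // S'.oneType x = τ} := fun a =>
      ⟨Sum.inl ⟨a.1, by rwa [a.2]⟩, by rw [hl, a.2]⟩
    have hf : Function.Bijective f := by
      refine ⟨fun a a' h => by simpa [f, Subtype.ext_iff] using h, ?_⟩
      rintro ⟨a | ⟨τ', i⟩, h⟩
      · exact ⟨⟨a.1, (hl a).symm.trans h⟩, rfl⟩
      · rw [hr] at h
        exact absurd (h ▸ τ'.2) hτ
    exact (Nat.card_congr (Equiv.ofBijective f hf)).symm
end

section
/- Let Γ be an SNF sentence over L with m existentially quantified conjuncts, and set δ = max(m(m+1), 2m+1). A configuration n is satisfiable with respect to Γ if and only if there exists a configuration n′ with n′(τ) ≤ δ for every 1-type τ such that n′ is satisfiable with respect to Γ and n′ ≼ n. -/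
/-- The 1-type of an element. -/
def Struc.typeOf {U B D : Type} (M : Struc U B D) (e : D) : OneType U B :=
  ⟨fun P => M.unary P e, fun R => M.binary R e e⟩

theorem realizes1_iff_typeOf_eq {U B D : Type} (M : Struc U B D) (e : D) (τ : OneType U B) :
    Realizes1 M e τ ↔ M.typeOf e = τ := by
  cases τ
  simp [Realizes1, Struc.typeOf, funext_iff]

theorem config_eq_card_typeOf {U B D : Type} (M : Struc U B D) (τ : OneType U B) :
    config M τ = Nat.card {e : D // M.typeOf e = τ} := by
  simp only [config, realizes1_iff_typeOf_eq]

theorem unary_iff_of_typeOf_eq {U B D : Type} {M : Struc U B D} {d e : D}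
    (h : M.typeOf d = M.typeOf e) (P : U) : M.unary P d ↔ M.unary P e :=
  iff_of_eq (congrFun (congrArg OneType.unary h) P)

theorem binary_self_iff_of_typeOf_eq {U B D : Type} {M : Struc U B D} {d e : D}
    (h : M.typeOf d = M.typeOf e) (R : B) : M.binary R d d ↔ M.binary R e e :=
  iff_of_eq (congrFun (congrArg OneType.binary h) R)

/-- The structure on `E` in which the pair `(a, b)` looks like the pair `(h b a, h a b)` of `M`. -/
def Struc.rewire {U B D E : Type} (M : Struc U B D) (h : E → E → D) : Struc U B E where
  unary P a := M.unary P (h a a)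
  binary R a b := M.binary R (h b a) (h a b)

theorem QF.eval_rewire {U B D E : Type} (M : Struc U B D) (h : E → E → D)
    (hh : ∀ a b, M.typeOf (h a b) = M.typeOf (h b b)) (a b : E) (φ : QF U B) :
    φ.Eval (M.rewire h) a b ↔ φ.Eval M (h b a) (h a b) := by
  induction φ with
  | uatom P v =>
    cases v
    · exact (unary_iff_of_typeOf_eq (hh b a) P).symm
    · exact (unary_iff_of_typeOf_eq (hh a b) P).symm
  | batom R v w =>
    cases v <;> cases w
    · exact (binary_self_iff_of_typeOf_eq (hh b a) R).symm
    · exact Iff.rfl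
    · exact Iff.rfl
    · exact (binary_self_iff_of_typeOf_eq (hh a b) R).symm
  | not f ih => simp only [QF.Eval, ih]
  | and f g ihf ihg => simp only [QF.Eval, ihf, ihg]
  | or f g ihf ihg => simp only [QF.Eval, ihf, ihg]

theorem typeOf_rewire {U B D E : Type} (M : Struc U B D) (h : E → E → D) (a : E) :
    (M.rewire h).typeOf a = M.typeOf (h a a) := rfl

theorem SNF.sat_rewire {U B D E : Type} {Γ : SNF U B} {M : Struc U B D} (hM : Γ.Sat M)
    (h : E → E → D) (hh : ∀ a b, M.typeOf (h a b) = M.typeOf (h b b))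
    (hw : ∀ k a, ∃ b, M.binary (Γ.beta k) (h b a) (h a b)) : Γ.Sat (M.rewire h) :=
  ⟨fun a b => (QF.eval_rewire M h hh a b Γ.phi).2 (hM.1 _ _), hw⟩

/-- On a finite set with at least `2m+1` elements there is an asymmetric relation in which every
element has `m` distinct successors. -/
theorem exists_asymmetric_successors {α : Type*} (S : Finset α) (m : ℕ)
    (hS : 2 * m + 1 ≤ S.card) :
    ∃ σ : α → Fin m → α, ∀ a ∈ S, Function.Injective (σ a) ∧
      ∀ k, σ a k ∈ S ∧ ∀ l, σ (σ a k) l ≠ a := by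
  classical
  have : NeZero S.card := ⟨by omega⟩
  let e : S ≃ ZMod S.card := Fintype.equivOfCardEq (by simp [ZMod.card])
  let σ : α → Fin m → α := fun a k =>
    if ha : a ∈ S then (e.symm (e ⟨a, ha⟩ + ((k.1 + 1 : ℕ) : ZMod S.card)) : α) else a
  have hσ : ∀ a (ha : a ∈ S) k,
      σ a k = (e.symm (e ⟨a, ha⟩ + ((k.1 + 1 : ℕ) : ZMod S.card)) : α) :=
    fun a ha k => dif_pos ha
  refine ⟨σ, fun a ha => ⟨fun k l hkl => ?_, fun k => ⟨?_, fun l hl => ?_⟩⟩⟩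
  · rw [hσ a ha, hσ a ha] at hkl
    have h := add_left_cancel (e.symm.injective (Subtype.ext hkl))
    rw [ZMod.natCast_eq_natCast_iff', Nat.mod_eq_of_lt (by omega), Nat.mod_eq_of_lt (by omega)] at h
    exact Fin.ext (by omega)
  · rw [hσ a ha]
    exact Subtype.coe_prop _
  · have hk : σ a k ∈ S := by
      rw [hσ a ha]
      exact Subtype.coe_prop _
    have hk' : (⟨σ a k, hk⟩ : S) = e.symm (e ⟨a, ha⟩ + ((k.1 + 1 : ℕ) : ZMod S.card)) :=
      Subtype.ext (hσ a ha k)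
    rw [hσ _ hk, hk', Equiv.apply_symm_apply] at hl
    have h : e.symm _ = (⟨a, ha⟩ : S) := Subtype.ext hl
    rw [Equiv.symm_apply_eq, add_assoc, add_eq_left, ← Nat.cast_add,
      ZMod.natCast_eq_zero_iff] at h
    have := Nat.le_of_dvd (by omega) h
    omega

/-- Given `m` functions `f k` and a set `T` with more than `m(m+1)` elements, some `b ∈ T` is not
an `f`-value of any point outside `T` that is an `f`-value of all but at most `m` points of `T`. -/
theorem exists_notMem_values_of_popular {D : Type*} [Fintype D] [DecidableEq D] {m : ℕ}
    (f : Fin m → D → D) (T : Finset D) (hT : m * (m + 1) < T.card) :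
    ∃ b ∈ T, ∀ a, (T.filter fun t => ∀ k, f k t ≠ a).card ≤ m → ∀ k, f k a ≠ b := by
  let P : Finset D := Finset.univ.filter fun a => (T.filter fun t => ∀ k, f k t ≠ a).card ≤ m
  have hP : P.card ≤ m := by
    have h := Finset.card_mul_le_card_mul (s := P) (t := T) (m := T.card - m) (n := m)
      (fun a t => ∃ k, f k t = a) ?_ ?_
    · by_contra! hlt
      have h1 : (m + 1) * (T.card - m) ≤ T.card * m := (Nat.mul_le_mul_right _ hlt).trans h
      obtain ⟨r, hr⟩ : ∃ r, T.card = m + r := Nat.exists_eq_add_of_le (by nlinarith)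
      rw [hr, Nat.add_sub_cancel_left] at h1
      nlinarith
    · intro a ha
      have ha' : (T.filter fun t => ∀ k, f k t ≠ a).card ≤ m := (Finset.mem_filter.1 ha).2
      have := Finset.card_filter_add_card_filter_not (s := T) (fun t => ∃ k, f k t = a)
      simp only [not_exists] at this
      simp only [ne_eq] at ha'
      simp only [Finset.bipartiteAbove]
      omega
    · intro t _
      calc _ ≤ (Finset.univ.image fun k => f k t).card := by
            refine Finset.card_le_card fun a ha => ?_
            simpa [Finset.bipartiteBelow] using (Finset.mem_filter.1 ha).2
        _ ≤ m := Finset.card_image_le.trans (by simp)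
  have hV : ((P ×ˢ Finset.univ).image fun p : D × Fin m => f p.2 p.1).card < T.card := by
    refine Finset.card_image_le.trans_lt ?_
    rw [Finset.card_product, Finset.card_univ, Fintype.card_fin]
    nlinarith
  obtain ⟨b, hbT, hb⟩ := Finset.exists_mem_notMem_of_card_lt_card hV
  refine ⟨b, hbT, fun a ha k hk => hb (Finset.mem_image.2 ⟨(a, k), ?_, hk⟩)⟩
  simpa [P] using ha

/-- If a 1-type is realized more than `max (m(m+1)) (2m+1)` times in a finite model, then the
model can be rewired after deleting some element of that 1-type. -/
theorem SNF.Sat.exists_remove {U B D : Type} [Fintype D] {Γ : SNF U B} {M : Struc U B D}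
    (hM : Γ.Sat M) (τ : OneType U B) (T : Finset D) (hT : ∀ x, x ∈ T ↔ M.typeOf x = τ)
    (hcard : max (Γ.m * (Γ.m + 1)) (2 * Γ.m + 1) < T.card) :
    ∃ b ∈ T, ∃ M' : Struc U B {x : D // x ≠ b},
      Γ.Sat M' ∧ ∀ x, M'.typeOf x = M.typeOf x.1 := by
  classical
  obtain ⟨hcard₁, hcard₂⟩ := max_lt_iff.1 hcard
  choose f hf using hM.2
  obtain ⟨b, hbT, hb⟩ := exists_notMem_values_of_popular f T hcard₁
  obtain ⟨σ, hσ⟩ := exists_asymmetric_successors (T.erase b) Γ.m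
    (by rw [Finset.card_erase_of_mem hbT]; omega)
  let Pop : D → Prop := fun a => (T.filter fun t => ∀ k, f k t ≠ a).card ≤ Γ.m
  -- the slots `c a k` in which `a` will find its witnesses of 1-type `τ`
  have hc : ∀ a, a ≠ b → ∃ c : Fin Γ.m → D, (a ∈ T ∨ ¬ Pop a) → Function.Injective c ∧
      (∀ k, c k ∈ T.erase b) ∧ (a ∉ T → ∀ k l, f l (c k) ≠ a) ∧ (a ∈ T → c = σ a) := by
    intro a hab
    by_cases haT : a ∈ T
    · have haE : a ∈ T.erase b := Finset.mem_erase.2 ⟨hab, haT⟩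
      exact ⟨σ a, fun _ => ⟨(hσ a haE).1, fun k => ((hσ a haE).2 k).1,
        fun h => absurd haT h, fun _ => rfl⟩⟩
    · by_cases hp : Pop a
      · exact ⟨fun _ => a, fun h => (h.elim haT (· hp)).elim⟩
      · have hp' : Γ.m < (T.filter fun t => ∀ k, f k t ≠ a).card := not_le.1 hp
        have hle : Γ.m ≤ ((T.filter fun t => ∀ k, f k t ≠ a).erase b).card := by
          have := Finset.pred_card_le_card_erase (s := T.filter fun t => ∀ k, f k t ≠ a) (a := b)
          omega
        obtain ⟨g⟩ : Nonempty (Fin Γ.m ↪ ((T.filter fun t => ∀ k, f k t ≠ a).erase b)) :=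
          Function.Embedding.nonempty_of_card_le
            (by rwa [Fintype.card_fin, Fintype.card_coe])
        have hg : ∀ k, (g k : D) ≠ b ∧ (g k : D) ∈ T ∧ ∀ l, f l (g k) ≠ a := fun k => by
          have := (g k).2
          rwa [Finset.mem_erase, Finset.mem_filter] at this
        exact ⟨fun k => g k, fun _ => ⟨fun k l h => g.injective (Subtype.ext h),
          fun k => Finset.mem_erase.2 ⟨(hg k).1, (hg k).2.1⟩, fun _ k l => (hg k).2.2 l,
          fun h => absurd h haT⟩⟩
  choose! c hc using hc
  let Q : D → D → Fin Γ.m → Prop := fun x y k => (x ∈ T ∨ ¬ Pop x) ∧ c x k = y ∧ f k x ∈ T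
  let h : D → D → D := fun x y => if hq : ∃ k, Q x y k then f hq.choose x else y
  have h_default : ∀ x y, (¬ ∃ k, Q x y k) → h x y = y := fun x y hq => dif_neg hq
  have h_slot : ∀ x, x ≠ b → ∀ k, (x ∈ T ∨ ¬ Pop x) → f k x ∈ T → h x (c x k) = f k x := by
    intro x hx k hg hk
    have hq : ∃ l, Q x (c x k) l := ⟨k, hg, rfl, hk⟩
    have : h x (c x k) = f hq.choose x := dif_pos hq
    rw [this, (hc x hx hg).1 hq.choose_spec.2.1]
  have h_type : ∀ x, x ≠ b → ∀ y, M.typeOf (h x y) = M.typeOf y := by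
    intro x hx y
    by_cases hq : ∃ k, Q x y k
    · have e : h x y = f hq.choose x := dif_pos hq
      obtain ⟨hg, hy, hT'⟩ := hq.choose_spec
      have hyT := Finset.mem_of_mem_erase ((hc x hx hg).2.1 hq.choose)
      rw [hy] at hyT
      rw [e, (hT _).1 hT', (hT _).1 hyT]
    · rw [h_default x y hq]
  have h_notMem : ∀ x, x ≠ b → ∀ y, y ∉ T → h x y = y := by
    rintro x hx y hy
    refine h_default x y ?_
    rintro ⟨k, hg, rfl, -⟩
    exact hy (Finset.mem_of_mem_erase ((hc x hx hg).2.1 k))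
  refine ⟨b, hbT, M.rewire fun x y => h x.1 y.1, SNF.sat_rewire hM _ ?_ ?_, ?_⟩
  · intro x y
    rw [h_type x x.2, h_type y y.2]
  · rintro k ⟨a, ha⟩
    suffices hs : ∃ y, y ≠ b ∧ h y a = a ∧ h a y = f k a by
      obtain ⟨y, hy, h₁, h₂⟩ := hs
      exact ⟨⟨y, hy⟩, by simpa only [h₁, h₂] using hf k a⟩
    by_cases hw : f k a ∈ T
    · by_cases hg : a ∈ T ∨ ¬ Pop a
      · obtain ⟨-, hcE, -, hcσ⟩ := hc a ha hg
        have hcb := Finset.ne_of_mem_erase (hcE k)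
        have hcT := Finset.mem_of_mem_erase (hcE k)
        refine ⟨c a k, hcb, ?_, h_slot a ha k hg hw⟩
        by_cases haT : a ∈ T
        · refine h_default _ _ ?_
          rintro ⟨l, -, hl, -⟩
          rw [(hc _ hcb (Or.inl hcT)).2.2.2 hcT, hcσ haT] at hl
          exact ((hσ a (Finset.mem_erase.2 ⟨ha, haT⟩)).2 k).2 l hl
        · exact h_notMem _ hcb a haT
      · obtain ⟨haT, hp⟩ := not_or.1 hg
        have hwb := hb a (not_not.1 hp) k
        refine ⟨f k a, hwb, h_notMem _ hwb a haT, h_default _ _ ?_⟩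
        rintro ⟨l, hg', -⟩
        exact hg hg'
    · have hwb : f k a ≠ b := fun e => hw (e ▸ hbT)
      refine ⟨f k a, hwb, h_default _ _ ?_, h_notMem a ha _ hw⟩
      rintro ⟨l, hg, hl, -⟩
      exact (hc _ hwb hg).2.2.1 hw l k (by rw [hl])
  · intro x
    exact h_type x x.2 x

theorem Derives.refl {U B : Type} (n : OneType U B → ℕ) : Derives n n :=
  fun _ => ⟨fun _ => le_rfl, fun _ => rfl⟩

theorem Derives.trans {U B : Type} {n₁ n₂ n₃ : OneType U B → ℕ} (h₁ : Derives n₁ n₂)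
    (h₂ : Derives n₂ n₃) : Derives n₁ n₃ := by
  intro τ
  have := h₁ τ
  have := h₂ τ
  omega

theorem SNF.Sat.exists_bounded {U B D : Type} [Fintype D] {Γ : SNF U B} {M : Struc U B D}
    (hM : Γ.Sat M) :
    ∃ n' : OneType U B → ℕ, (∀ τ, n' τ ≤ max (Γ.m * (Γ.m + 1)) (2 * Γ.m + 1)) ∧
      SatConfig Γ n' ∧ Derives n' (config M) := by
  classical
  induction hN : Fintype.card D using Nat.strong_induction_on generalizing D with
  | _ N ih =>
    by_cases hbd : ∀ τ, config M τ ≤ max (Γ.m * (Γ.m + 1)) (2 * Γ.m + 1)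
    · exact ⟨config M, hbd, ⟨D, inferInstance, M, hM, rfl⟩, Derives.refl _⟩
    · push Not at hbd
      obtain ⟨τ, hτ⟩ := hbd
      let T : Finset D := Finset.univ.filter fun x => M.typeOf x = τ
      have hT : ∀ x, x ∈ T ↔ M.typeOf x = τ := fun x => by simp [T]
      have hTc : T.card = config M τ := by
        rw [config_eq_card_typeOf, Nat.card_eq_fintype_card, Fintype.card_subtype]
      obtain ⟨b, hbT, M', hM', htype⟩ := hM.exists_remove τ T hT (hTc ▸ hτ)
      obtain ⟨n', hn', hs, hd⟩ := ih _ (hN ▸ Fintype.card_subtype_lt (x := b) (by simp)) hM' rfl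
      refine ⟨n', hn', hs, hd.trans fun ρ => ⟨fun _ => ?_, fun h0 => ?_⟩⟩
      · rw [config_eq_card_typeOf, config_eq_card_typeOf]
        exact Nat.card_le_card_of_injective
          (fun x => ⟨x.1.1, (htype x.1).symm.trans x.2⟩)
          (fun x y hxy => Subtype.ext (Subtype.ext (Subtype.mk.inj hxy)))
      · rw [h0]
        rw [config_eq_card_typeOf, Finite.card_eq_zero_iff] at h0 ⊢
        have hne : ∀ x, x ≠ b → M.typeOf x ≠ ρ := fun x hx hxρ =>
          h0.false ⟨⟨x, hx⟩, (htype ⟨x, hx⟩).trans hxρ⟩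
        refine ⟨fun ⟨x, hx⟩ => ?_⟩
        by_cases hxb : x = b
        · obtain ⟨y, hy, hyb⟩ := Finset.exists_mem_ne
            (show 1 < T.card by have := le_max_right (Γ.m * (Γ.m + 1)) (2 * Γ.m + 1); omega) b
          exact hne y hyb (((hT y).1 hy).trans (((hT b).1 hbT).symm.trans (hxb ▸ hx)))
        · exact hne x hxb hx

/-- Satisfiability of configurations is preserved along derivations, by duplicating elements. -/
theorem SatConfig.of_derives {U B : Type} {Γ : SNF U B} {n' n : OneType U B → ℕ}
    (hn' : SatConfig Γ n') (hd : Derives n' n) : SatConfig Γ n := by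
  classical
  obtain ⟨D, _, M, hM, rfl⟩ := hn'
  have hsurj : ∀ t : Set.range M.typeOf,
      ∃ g : Fin (n t) → {e : D // M.typeOf e = t}, Function.Surjective g := by
    rintro ⟨t, e, he⟩
    have : Nonempty {e : D // M.typeOf e = t} := ⟨⟨e, he⟩⟩
    have hle : Nat.card {e : D // M.typeOf e = t} ≤ n t := by
      have := (hd t).1
      rw [config_eq_card_typeOf] at this
      exact this Nat.card_pos
    rw [Nat.card_eq_fintype_card] at hle
    obtain ⟨g⟩ : Nonempty ({e : D // M.typeOf e = t} ↪ Fin (n t)) :=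
      Function.Embedding.nonempty_of_card_le (by simpa using hle)
    exact ⟨Function.invFun g, Function.invFun_surjective g.injective⟩
  choose g hg using hsurj
  let i : (Σ t : Set.range M.typeOf, Fin (n t)) → D := fun x => (g x.1 x.2).1
  have hi : ∀ x, M.typeOf (i x) = x.1 := fun x => (g x.1 x.2).2
  refine ⟨Σ t : Set.range M.typeOf, Fin (n t), Fintype.ofFinite _, M.rewire fun _ y => i y,
    SNF.sat_rewire hM _ (fun _ _ => rfl) ?_, ?_⟩
  · intro k a
    obtain ⟨w, hw⟩ := hM.2 k (i a)
    obtain ⟨j, hj⟩ := hg ⟨M.typeOf w, w, rfl⟩ ⟨w, rfl⟩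
    refine ⟨⟨⟨M.typeOf w, w, rfl⟩, j⟩, ?_⟩
    have : i ⟨⟨M.typeOf w, w, rfl⟩, j⟩ = w := congrArg Subtype.val hj
    simpa only [this] using hw
  · funext τ
    simp only [config_eq_card_typeOf, typeOf_rewire, hi]
    by_cases hτ : τ ∈ Set.range M.typeOf
    · have hbij : Function.Bijective (fun j : Fin (n τ) =>
          (⟨⟨⟨τ, hτ⟩, j⟩, rfl⟩ :
            {x : Σ t : Set.range M.typeOf, Fin (n t) // (x.1 : OneType U B) = τ})) := by
        refine ⟨fun j l hjl => by simpa using hjl, ?_⟩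
        rintro ⟨⟨⟨t, ht⟩, j⟩, rfl⟩
        exact ⟨j, rfl⟩
      simpa using (Nat.card_eq_of_bijective _ hbij).symm
    · have h0 : config M τ = 0 := by
        rw [config_eq_card_typeOf, Finite.card_eq_zero_iff]
        exact ⟨fun x => hτ ⟨x.1, x.2⟩⟩
      rw [(hd τ).2 h0, h0, Finite.card_eq_zero_iff]
      exact ⟨fun x => hτ (x.2 ▸ x.1.1.2)⟩

/-- With `δ = max (m(m+1)) (2m+1)`, a configuration `n` is
satisfiable w.r.t. `Γ` iff some satisfiable configuration `n'` bounded by `δ`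
satisfies `n' ≼ n`. -/
theorem statement4 {U B : Type} [Fintype U] [Fintype B] (Γ : SNF U B)
    (n : OneType U B → ℕ) :
    SatConfig Γ n ↔
      ∃ n' : OneType U B → ℕ,
        (∀ τ, n' τ ≤ max (Γ.m * (Γ.m + 1)) (2 * Γ.m + 1)) ∧
        SatConfig Γ n' ∧ Derives n' n := by
  constructor
  · rintro ⟨D, _, M, hM, rfl⟩
    exact hM.exists_bounded
  · rintro ⟨n', -, hs, hd⟩
    exact hs.of_derives hd
end

section
/- Let Γ be an SNF sentence over L with m existentially quantified conjuncts, where L has exactly r relation symbols, and set δ = max(m(m+1), 2m+1). If there exists a nonempty finite L-structure M with M ⊨ Γ, then there exists a finite L-structure M′ with M′ ⊨ Γ whose cardinality is at least 1 and at most δ · 2^r. -/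
/-- The atomic formulas `P(x)`, `R(x,x)` satisfied by an element. -/
def Struc.atoms {U B D : Type} (M : Struc U B D) (e : D) : U ⊕ B → Prop :=
  Sum.elim (fun P => M.unary P e) (fun R => M.binary R e e)

/-- The structure on `E` in which the pair `(x, y)` has the 2-type of `(p x y, p y x)` in `M`. -/
def Struc.pairPull {U B D E : Type} (M : Struc U B D) (p : E → E → D) : Struc U B E where
  unary P x := M.unary P (p x x)
  binary R x y := M.binary R (p x y) (p y x)

theorem Struc.eval_pairPull {U B D E : Type} (M : Struc U B D) (p : E → E → D)
    (hp : ∀ x y, M.atoms (p x y) = M.atoms (p x x)) (f : QF U B) (x y : E) :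
    f.Eval (M.pairPull p) x y ↔ f.Eval M (p x y) (p y x) := by
  have hU (P : U) (x y : E) : M.unary P (p x x) ↔ M.unary P (p x y) :=
    iff_of_eq (congrFun (hp x y) (.inl P)).symm
  have hB (R : B) (x y : E) : M.binary R (p x x) (p x x) ↔ M.binary R (p x y) (p x y) :=
    iff_of_eq (congrFun (hp x y) (.inr R)).symm
  induction f with
  | uatom P v => cases v <;> simp [QF.Eval, pairPull, hU P x y, hU P y x]
  | batom R v w => cases v <;> cases w <;> simp [QF.Eval, pairPull, hB R x y, hB R y x]
  | not f ih => simp only [QF.Eval, ih]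
  | and f g ihf ihg => simp only [QF.Eval, ihf, ihg]
  | or f g ihf ihg => simp only [QF.Eval, ihf, ihg]

/-- `Γ` has a model with at most `3m` elements per 1-type: each 1-type gets three layers of `m`
elements, and an element of layer `i` has its `k`-th witness at position `k` of layer `i + 1`. -/
theorem SNF.Sat.exists_layered {U B D : Type} {Γ : SNF U B} {M : Struc U B D} (h : Γ.Sat M) :
    ∃ S : Struc U B (Set.range M.atoms × Fin 3 × Fin Γ.m), Γ.Sat S := by
  classical
  choose rep hrep using fun t : Set.range M.atoms => t.2
  choose w hw using fun (t : Set.range M.atoms) (k : Fin Γ.m) => h.2 k (rep t)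
  let p (x y : Set.range M.atoms × Fin 3 × Fin Γ.m) : D :=
    if x.2.1 = y.2.1 + 1 ∧ M.atoms (w y.1 x.2.2) = x.1 then w y.1 x.2.2 else rep x.1
  have hp (x y) : M.atoms (p x y) = x.1 := by
    by_cases hc : x.2.1 = y.2.1 + 1 ∧ M.atoms (w y.1 x.2.2) = x.1
    · simp only [p, if_pos hc, hc.2]
    · simp only [p, if_neg hc, hrep]
  refine ⟨M.pairPull p, fun x y => ?_, fun k x => ?_⟩
  · exact (M.eval_pairPull p (fun x y => (hp x y).trans (hp x x).symm) _ x y).2 (h.1 _ _)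
  · refine ⟨(⟨M.atoms (w x.1 k), _, rfl⟩, x.2.1 + 1, k), ?_⟩
    have hlayer : ∀ i : Fin 3, i ≠ i + 1 + 1 := by decide
    simpa [Struc.pairPull, p, hlayer] using hw x.1 k

/-- With `δ = max (m(m+1)) (2m+1)` and `r` the number of
relation symbols of `L`, if `Γ` has a nonempty finite model, then it has a
finite model of cardinality between `1` and `δ · 2^r`. -/
theorem statement5 {U B : Type} [Fintype U] [Fintype B] (Γ : SNF U B)
    (h : ∃ (D : Type) (_ : Fintype D) (M : Struc U B D), Nonempty D ∧ Γ.Sat M) :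
    ∃ (D : Type) (_ : Fintype D) (M : Struc U B D), Γ.Sat M ∧
      1 ≤ Nat.card D ∧
      Nat.card D ≤
        max (Γ.m * (Γ.m + 1)) (2 * Γ.m + 1) * 2 ^ (Fintype.card U + Fintype.card B) := by
  classical
  obtain ⟨D, _, M, ⟨d⟩, hM⟩ := h
  rcases Nat.eq_zero_or_pos Γ.m with hm | hm
  · refine ⟨Unit, inferInstance, M.pairPull fun _ _ => d, ⟨fun x y => ?_, fun k => ?_⟩, ?_, ?_⟩
    · exact (M.eval_pairPull _ (fun _ _ => rfl) _ x y).2 (hM.1 _ _)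
    · exact (hm ▸ k).elim0
    · simp
    · simpa [hm] using Nat.one_le_two_pow
  · obtain ⟨S, hS⟩ := hM.exists_layered
    refine ⟨_, inferInstance, S, hS, ?_, ?_⟩
    · have : Nonempty (Set.range M.atoms × Fin 3 × Fin Γ.m) :=
        ⟨⟨M.atoms d, d, rfl⟩, 0, ⟨0, hm⟩⟩
      exact Nat.card_pos
    · have hT : Nat.card (Set.range M.atoms) ≤ 2 ^ (Fintype.card U + Fintype.card B) := by
        refine (Finite.card_subtype_le _).trans_eq ?_
        simp [Nat.card_eq_fintype_card]
      have hδ : 3 * Γ.m ≤ max (Γ.m * (Γ.m + 1)) (2 * Γ.m + 1) := by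
        rcases Nat.lt_or_ge Γ.m 2 with h2 | h2
        · exact le_max_of_le_right (by omega)
        · exact le_max_of_le_left (by nlinarith)
      rw [Nat.card_prod, Nat.card_prod, Nat.card_fin, Nat.card_fin, mul_comm]
      exact Nat.mul_le_mul hδ hT
end

section
/- Let Γ be an SNF sentence over L, let Δ be a finite set partitioned into two disjoint subsets Δ⊤ and Δ⊥, let A be an L-structure with domain Δ, and let D ⊆ Δ × Δ be a symmetric set of pairs that contains every pair (x,y) with x ∈ Δ⊤, or y ∈ Δ⊤, or x = y. Assume: (H1) for every (x,y) ∈ D with x ∈ Δ⊤ or y ∈ Δ⊤, the formula φ(x,y) holds in A; and (H2) for every e ∈ Δ⊤ and every k ∈ {1,…,m} there exists e′ ∈ Δ with β_k^A(e, e′). Then the following are equivalent: (i) there exists an L-structure M with domain Δ such that M ⊨ Γ and M agrees with A on every pair in D; (ii) there exists an L′-structure M′ with domain Δ⊥ such that M′ ⊨ Γ′, the L-part of M′ agrees with A on every pair in D ∩ (Δ⊥ × Δ⊥), and for every e ∈ Δ⊥ and every k ∈ {1,…,m}: Z_k^{M′}(e) holds iff there is no e′ ∈ Δ⊤ with β_k^A(e,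 e′). -/
/-- An `L'`-structure, where `L'` extends `L` with `m` fresh unary relation
symbols `Z_1, …, Z_m`. -/
structure StrucZ (U B : Type) (m : ℕ) (D : Type) where
  unary : U → D → Prop
  binary : B → D → D → Prop
  Z : Fin m → D → Prop

/-- The `L`-part of an `L'`-structure. -/
def StrucZ.toStruc {U B : Type} {m : ℕ} {D : Type} (S : StrucZ U B m D) :
    Struc U B D :=
  ⟨S.unary, S.binary⟩

/-- Satisfaction of the auxiliary sentence
`Γ' = (∀x∀y φ(x,y)) ∧ ⋀_{k=1}^m ∀x (Z_k(x) → ∃y β_k(x,y))`. -/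
def SatZ {U B D : Type} (Γ : SNF U B) (S : StrucZ U B Γ.m D) : Prop :=
  (∀ a b, Γ.phi.Eval S.toStruc a b) ∧
    ∀ k a, S.Z k a → ∃ b, S.binary (Γ.beta k) a b

/-- The value of a quantifier-free formula depends only on the atoms over its two arguments. -/
theorem QF.eval_congr_s7 {U B D E : Type} {S : Struc U B D} {T : Struc U B E} {a b : D} {c d : E}
    (ha : ∀ P, S.unary P a ↔ T.unary P c) (hb : ∀ P, S.unary P b ↔ T.unary P d)
    (haa : ∀ R, S.binary R a a ↔ T.binary R c c) (hab : ∀ R, S.binary R a b ↔ T.binary R c d)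
    (hba : ∀ R, S.binary R b a ↔ T.binary R d c) (hbb : ∀ R, S.binary R b b ↔ T.binary R d d)
    (f : QF U B) : f.Eval S a b ↔ f.Eval T c d := by
  induction f with
  | uatom P v => cases v <;> simp [QF.Eval, ha, hb]
  | batom R v w => cases v <;> cases w <;> simp [QF.Eval, haa, hab, hba, hbb]
  | not f ih => simp only [QF.Eval, ih]
  | and f g ihf ihg => simp only [QF.Eval, ihf, ihg]
  | or f g ihf ihg => simp only [QF.Eval, ihf, ihg]

/-- The structure on `D` with the unary relations of `A` whose binary relations are those of `N`
on pairs outside `T` and those of `A` on all other pairs. -/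
def Struc.glue {U B D : Type} (A : Struc U B D) (T : Set D) (N : Struc U B {e : D // e ∉ T}) :
    Struc U B D where
  unary := A.unary
  binary R x y :=
    (∃ (hx : x ∉ T) (hy : y ∉ T), N.binary R ⟨x, hx⟩ ⟨y, hy⟩) ∨
      ((x ∈ T ∨ y ∈ T) ∧ A.binary R x y)

theorem Struc.glue_binary_of_notMem {U B D : Type} (A : Struc U B D) {T : Set D}
    (N : Struc U B {e : D // e ∉ T}) (R : B) {x y : D} (hx : x ∉ T) (hy : y ∉ T) :
    (A.glue T N).binary R x y ↔ N.binary R ⟨x, hx⟩ ⟨y, hy⟩ := by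
  simp [Struc.glue, hx, hy]

theorem Struc.glue_binary_of_mem {U B D : Type} (A : Struc U B D) {T : Set D}
    (N : Struc U B {e : D // e ∉ T}) (R : B) {x y : D} (h : x ∈ T ∨ y ∈ T) :
    (A.glue T N).binary R x y ↔ A.binary R x y := by
  rcases h with h | h <;> simp [Struc.glue, h]

/-- Domain reduction: with `Δ⊥ = Δ⊤ᶜ`, under hypotheses (H1)
and (H2), there is an `L`-structure `M` on `Δ` with `M ⊨ Γ` agreeing with `A`
on every pair in `D` iff there is an `L'`-structure `M'` on `Δ⊥` with
`M' ⊨ Γ'`, whose `L`-part agrees with `A` on every pair of `D` inside `Δ⊥`,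
and whose `Z_k` hold exactly at the elements having no `β_k`-witness in `Δ⊤`
under `A`. -/
theorem statement7 {U B D : Type} [Fintype U] [Fintype B] [Fintype D]
    (Γ : SNF U B) (Δtop : Set D) (A : Struc U B D) (Dp : Set (D × D))
    (hsym : ∀ x y, (x, y) ∈ Dp → (y, x) ∈ Dp)
    (hcover : ∀ x y, (x ∈ Δtop ∨ y ∈ Δtop ∨ x = y) → (x, y) ∈ Dp)
    (H1 : ∀ x y, (x, y) ∈ Dp → (x ∈ Δtop ∨ y ∈ Δtop) → Γ.phi.Eval A x y)
    (H2 : ∀ e ∈ Δtop, ∀ k, ∃ e', A.binary (Γ.beta k) e e') :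
    (∃ M : Struc U B D, Γ.Sat M ∧
        ∀ x y, (x, y) ∈ Dp →
          (∀ R, M.binary R x y ↔ A.binary R x y) ∧
          (∀ P, M.unary P x ↔ A.unary P x) ∧
          (∀ P, M.unary P y ↔ A.unary P y)) ↔
    (∃ M' : StrucZ U B Γ.m {e : D // e ∉ Δtop},
        SatZ Γ M' ∧
        (∀ x y : {e : D // e ∉ Δtop}, (x.1, y.1) ∈ Dp →
          (∀ R, M'.binary R x y ↔ A.binary R x.1 y.1) ∧
          (∀ P, M'.unary P x ↔ A.unary P x.1) ∧
          (∀ P, M'.unary P y ↔ A.unary P y.1)) ∧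
        (∀ (e : {e : D // e ∉ Δtop}) k,
          M'.Z k e ↔ ¬ ∃ e' ∈ Δtop, A.binary (Γ.beta k) e.1 e')) := by
  constructor
  · rintro ⟨M, ⟨hφ, hβ⟩, hA⟩
    refine ⟨⟨fun P x => M.unary P x.1, fun R x y => M.binary R x.1 y.1,
      fun k e => ¬ ∃ e' ∈ Δtop, A.binary (Γ.beta k) e.1 e'⟩, ⟨fun a b => ?_, fun k a ha => ?_⟩,
      fun x y h => hA x.1 y.1 h, fun e k => Iff.rfl⟩
    · refine (QF.eval_congr_s7 ?_ ?_ ?_ ?_ ?_ ?_ Γ.phi).1 (hφ a.1 b.1) <;> exact fun _ => Iff.rfl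
    · obtain ⟨b, hb⟩ := hβ k a.1
      have hbT : b ∉ Δtop := fun h =>
        ha ⟨b, h, ((hA a.1 b (hcover _ _ (.inr (.inl h)))).1 _).1 hb⟩
      exact ⟨⟨b, hbT⟩, hb⟩
  · rintro ⟨M', ⟨hφ, hβ⟩, hA, hZ⟩
    let M := A.glue Δtop M'.toStruc
    have hM : ∀ x y, (x, y) ∈ Dp → ∀ R, M.binary R x y ↔ A.binary R x y := by
      intro x y h R
      by_cases hxy : x ∈ Δtop ∨ y ∈ Δtop
      · exact A.glue_binary_of_mem _ R hxy
      · push Not at hxy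
        exact (A.glue_binary_of_notMem _ R hxy.1 hxy.2).trans
          ((hA ⟨x, hxy.1⟩ ⟨y, hxy.2⟩ h).1 R)
    have hdiag : ∀ x, (x, x) ∈ Dp := fun x => hcover x x (.inr (.inr rfl))
    have hu : ∀ (x : {e : D // e ∉ Δtop}) P, M.unary P x.1 ↔ M'.toStruc.unary P x :=
      fun x P => ((hA x x (hdiag x.1)).2.1 P).symm
    refine ⟨M, ⟨fun a b => ?_, fun k a => ?_⟩,
      fun x y h => ⟨hM x y h, fun _ => Iff.rfl, fun _ => Iff.rfl⟩⟩
    · by_cases hab : a ∈ Δtop ∨ b ∈ Δtop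
      · have hD : (a, b) ∈ Dp := hcover a b (by tauto)
        exact (QF.eval_congr_s7 (S := M) (T := A) (fun _ => Iff.rfl) (fun _ => Iff.rfl)
          (hM a a (hdiag a)) (hM a b hD)
          (hM b a (hsym a b hD)) (hM b b (hdiag b)) Γ.phi).2 (H1 a b hD hab)
      · push Not at hab
        obtain ⟨ha, hb⟩ := hab
        exact (QF.eval_congr_s7 (hu ⟨a, ha⟩) (hu ⟨b, hb⟩)
          (fun R => A.glue_binary_of_notMem _ R ha ha)
          (fun R => A.glue_binary_of_notMem _ R ha hb)
          (fun R => A.glue_binary_of_notMem _ R hb ha)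
          (fun R => A.glue_binary_of_notMem _ R hb hb) Γ.phi).2 (hφ ⟨a, ha⟩ ⟨b, hb⟩)
    · by_cases ha : a ∈ Δtop
      · obtain ⟨b, hb⟩ := H2 a ha k
        exact ⟨b, (A.glue_binary_of_mem _ _ (.inl ha)).2 hb⟩
      · by_cases hw : ∃ e' ∈ Δtop, A.binary (Γ.beta k) a e'
        · obtain ⟨b, hbT, hb⟩ := hw
          exact ⟨b, (A.glue_binary_of_mem _ _ (.inr hbT)).2 hb⟩
        · obtain ⟨b, hb⟩ := hβ k ⟨a, ha⟩ ((hZ ⟨a, ha⟩ k).2 hw)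
          exact ⟨b.1, (A.glue_binary_of_notMem _ _ ha b.2).2 hb⟩
end

section
/- Let Δ⊥ be a finite set, let A be an L′-structure with domain Δ⊥, let e* ∈ Δ⊥, and let Δ+ ⊆ Δ⊥ \ {e*}. Then the following are equivalent: (i) there exists an L′-structure M′ with domain Δ⊥ such that M′ ⊨ Γ′, and M′ agrees with A on every unary atomic value (for every unary symbol P of L′ and every e ∈ Δ⊥, P^{M′}(e) holds iff P^A(e) holds), on every diagonal binary value (for every binary symbol R of L and every e ∈ Δ⊥, R^{M′}(e,e) holds iff R^A(e,e) holds), and on both binary values of every pair (e*, e) with e ∈ Δ+ (for every binary symbol R of L, R^{M′}(e*,e) holds iff R^A(e*,e) holds and R^{M′}(e,e*) holds iff R^A(e,e*) holds); (ii) there exists an L̂-structure M̂ with domain Δ⊥ such that M̂ ⊨ Γ̂, the L′-part of M̂ agrees with A on every unary atomic value of L′ and on every diagonal binary value of L as in (i), T^{M̂}(e) holds iff e = e*, and for every 2-type π of L and every e ∈ Δ⊥: R_π^{M̂}(e) holds iff either (a) e = e* and for every binary symbol R of L, π makes R(x,y) true iff R^A(e*,e*) holds and π makes R(y,x) true iff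 R^A(e*,e*) holds, or (b) e ∈ Δ+ and the pair (e*, e) realizes π in A. -/
/-- A 2-type of `L`: a truth-value assignment to each of the atomic formulas
`R(x,y)` and `R(y,x)` for binary symbols `R`. -/
structure TwoType (B : Type) where
  xy : B → Prop
  yx : B → Prop

/-- The pair `(a, b)` realizes the 2-type `π` in the structure `S`; equivalently,
the formula `π(x,y)` holds of `(a, b)` in `S`. -/
def Realizes2 {U B D : Type} (S : Struc U B D) (a b : D) (π : TwoType B) : Prop :=
  ∀ R, (S.binary R a b ↔ π.xy R) ∧ (S.binary R b a ↔ π.yx R)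

/-- An `L̂`-structure, where `L̂` extends `L'` with a fresh unary symbol `T` and
a fresh unary symbol `R_π` for every 2-type `π` of `L`. -/
structure StrucHat (U B : Type) (m : ℕ) (D : Type) where
  unary : U → D → Prop
  binary : B → D → D → Prop
  Z : Fin m → D → Prop
  T : D → Prop
  Rp : TwoType B → D → Prop

/-- The `L'`-part of an `L̂`-structure. -/
def StrucHat.toStrucZ {U B : Type} {m : ℕ} {D : Type} (S : StrucHat U B m D) :
    StrucZ U B m D :=
  ⟨S.unary, S.binary, S.Z⟩

/-- The `L`-part of an `L̂`-structure. -/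
def StrucHat.toStruc {U B : Type} {m : ℕ} {D : Type} (S : StrucHat U B m D) :
    Struc U B D :=
  ⟨S.unary, S.binary⟩

/-- Satisfaction of the auxiliary sentence
`Γ̂ = Γ' ∧ ⋀_π ∀x∀y (T(x) ∧ R_π(y) → π(x,y)) ∧ ∀x (T(x) → ⋁_π R_π(x))`. -/
def SatHat {U B D : Type} (Γ : SNF U B) (S : StrucHat U B Γ.m D) : Prop :=
  SatZ Γ S.toStrucZ ∧
  (∀ (π : TwoType B) a b, S.T a → S.Rp π b → Realizes2 S.toStruc a b π) ∧
  (∀ a, S.T a → ∃ π : TwoType B, S.Rp π a)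

/-- Unary encoding of binary facts: given an `L'`-structure `A`
on the finite set `Δ⊥`, a target element `e* ∈ Δ⊥` and `Δ+ ⊆ Δ⊥ \ {e*}`, there
is a model `M' ⊨ Γ'` on `Δ⊥` agreeing with `A` on all unary atomic values, all
diagonal binary values and both binary values of every pair `(e*, e)` with
`e ∈ Δ+`, iff there is a model `M̂ ⊨ Γ̂` on `Δ⊥` whose `L'`-part has the same
agreements with `A`, whose `T` holds exactly at `e*`, and whose `R_π` hold
exactly as prescribed by the 2-types of `A` at `e*` and at elements of `Δ+`. -/
theorem statement8 {U B D : Type} [Fintype U] [Fintype B] [Fintype D]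
    (Γ : SNF U B) (A : StrucZ U B Γ.m D) (estar : D) (Δplus : Set D)
    (hplus : estar ∉ Δplus) :
    (∃ M' : StrucZ U B Γ.m D, SatZ Γ M' ∧
        (∀ P e, M'.unary P e ↔ A.unary P e) ∧
        (∀ k e, M'.Z k e ↔ A.Z k e) ∧
        (∀ R e, M'.binary R e e ↔ A.binary R e e) ∧
        (∀ e ∈ Δplus, ∀ R,
          (M'.binary R estar e ↔ A.binary R estar e) ∧
          (M'.binary R e estar ↔ A.binary R e estar))) ↔
    (∃ Mh : StrucHat U B Γ.m D, SatHat Γ Mh ∧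
        (∀ P e, Mh.unary P e ↔ A.unary P e) ∧
        (∀ k e, Mh.Z k e ↔ A.Z k e) ∧
        (∀ R e, Mh.binary R e e ↔ A.binary R e e) ∧
        (∀ e, Mh.T e ↔ e = estar) ∧
        (∀ (π : TwoType B) e, Mh.Rp π e ↔
          ((e = estar ∧ ∀ R, (π.xy R ↔ A.binary R estar estar) ∧
              (π.yx R ↔ A.binary R estar estar)) ∨
           (e ∈ Δplus ∧ Realizes2 A.toStruc estar e π)))) := by
  constructor
  · rintro ⟨M, hM, hU, hZ, hD, hP⟩
    refine ⟨⟨M.unary, M.binary, M.Z, fun e => e = estar, fun π e =>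
      (e = estar ∧ ∀ R, (π.xy R ↔ A.binary R estar estar) ∧
        (π.yx R ↔ A.binary R estar estar)) ∨
      (e ∈ Δplus ∧ Realizes2 A.toStruc estar e π)⟩, ⟨hM, ?_, ?_⟩, hU, hZ, hD,
      fun _ => Iff.rfl, fun _ _ => Iff.rfl⟩
    · rintro π a b rfl (⟨rfl, h⟩ | ⟨hb, h⟩) R
      · exact ⟨(hD R _).trans (h R).1.symm, (hD R _).trans (h R).2.symm⟩
      · exact ⟨(hP b hb R).1.trans (h R).1, (hP b hb R).2.trans (h R).2⟩
    · rintro a rfl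
      exact ⟨⟨fun R => A.binary R a a, fun R => A.binary R a a⟩,
        Or.inl ⟨rfl, fun _ => ⟨Iff.rfl, Iff.rfl⟩⟩⟩
  · rintro ⟨M, ⟨hM, hR, -⟩, hU, hZ, hD, hT, hRp⟩
    refine ⟨M.toStrucZ, hM, hU, hZ, hD, fun e he R => ?_⟩
    exact hR ⟨fun R => A.binary R estar e, fun R => A.binary R e estar⟩ estar e
      ((hT estar).2 rfl) ((hRp _ e).2 (Or.inr ⟨he, fun _ => ⟨Iff.rfl, Iff.rfl⟩⟩)) R
end
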